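/- arXiv:1411.5712 — 3 statements merged into one kernel-verified Lean document; each statement's English description precedes it below -/
import Mathlib

section
/- Let s be a strong equilibrium of a capacitated fair cost-sharing congestion game with n agents, and let s* be a feasible profile such that for every set C of agents, the combined profile that plays s*_i for i ∈ C and s_i for i ∉ C is feasible. Let c_max be the maximum capacity of a resource. Then the social cost of s is at most H_{c_max} times the social cost of s*. -/
/-- The load of resource `e` under profile `s`: the number of agents whose strategy
contains `e`. -/
def resLoad {n : ℕ} {E : Type*} [Fintype E] [DecidableEq E]
    (s : Fin n → Finset E) (e : E) : ℕ :=
  (Finset.univ.filter fun i => e ∈ s i).card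

/-- A profile is feasible if no resource load exceeds its capacity. -/
def FeasibleC {n : ℕ} {E : Type*} [Fintype E] [DecidableEq E]
    (c : E → ℕ) (s : Fin n → Finset E) : Prop :=
  ∀ e, resLoad s e ≤ c e

/-- The cost of agent `i`: the sum, over the resources she uses, of the resource cost
divided equally among its users. -/
noncomputable def agentCostC {n : ℕ} {E : Type*} [Fintype E] [DecidableEq E]
    (p : E → ℝ) (s : Fin n → Finset E) (i : Fin n) : ℝ :=
  ∑ e ∈ s i, p e / (resLoad s e : ℝ)

/-- The social cost of a profile: the sum of all agents' costs. -/
noncomputable def socialCostC {n : ℕ} {E : Type*} [Fintype E] [DecidableEq E]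
    (p : E → ℝ) (s : Fin n → Finset E) : ℝ :=
  ∑ i, agentCostC p s i

/-- A profile of allowed strategies is a strong equilibrium if it is feasible and no
nonempty coalition has a feasible deviation (into allowed strategies) that strictly
decreases the cost of each of its members. -/
def IsStrongEqC {n : ℕ} {E : Type*} [Fintype E] [DecidableEq E]
    (St : Fin n → Set (Finset E)) (p : E → ℝ) (c : E → ℕ) (s : Fin n → Finset E) : Prop :=
  (∀ i, s i ∈ St i) ∧ FeasibleC c s ∧
    ¬ ∃ (C : Finset (Fin n)) (s' : Fin n → Finset E),
        C.Nonempty ∧ (∀ i, s' i ∈ St i) ∧ FeasibleC c s' ∧ (∀ i ∉ C, s' i = s i) ∧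
        ∀ i ∈ C, agentCostC p s' i < agentCostC p s i

/-- The `m`-th harmonic number `1 + 1/2 + ⋯ + 1/m` (with value `0` at `m = 0`). -/
noncomputable def harmonicReal (m : ℕ) : ℝ :=
  ∑ i ∈ Finset.range m, (1 : ℝ) / (i + 1)

/-- The number of members of the coalition `C` whose strategy in `s` contains `e`. -/
def coalitionLoad {n : ℕ} {E : Type*} [DecidableEq E]
    (s : Fin n → Finset E) (C : Finset (Fin n)) (e : E) : ℕ :=
  (C.filter fun i => e ∈ s i).card

theorem harmonicReal_succ (m : ℕ) : harmonicReal (m + 1) = harmonicReal m + 1 / ((m : ℝ) + 1) :=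
  Finset.sum_range_succ _ _

theorem harmonicReal_mono : Monotone harmonicReal :=
  monotone_nat_of_le_succ fun m => by
    rw [harmonicReal_succ]
    have : (0 : ℝ) ≤ 1 / ((m : ℝ) + 1) := by positivity
    linarith

theorem socialCostC_eq_sum_resources {n : ℕ} {E : Type*} [Fintype E] [DecidableEq E]
    (p : E → ℝ) (s : Fin n → Finset E) :
    socialCostC p s = ∑ e, (resLoad s e : ℝ) * (p e / resLoad s e) := by
  unfold socialCostC agentCostC
  rw [Finset.sum_comm' (t' := Finset.univ) (s' := fun e => Finset.univ.filter fun i => e ∈ s i)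
    (by simp)]
  simp [resLoad]

theorem coalitionLoad_le_resLoad_combined {n : ℕ} {E : Type*} [Fintype E] [DecidableEq E]
    (s t : Fin n → Finset E) (C : Finset (Fin n)) (e : E) :
    coalitionLoad t C e ≤ resLoad (fun i => if i ∈ C then t i else s i) e := by
  refine Finset.card_le_card fun i hi => ?_
  obtain ⟨hiC, hie⟩ := Finset.mem_filter.1 hi
  simp [hiC, hie]

theorem coalitionLoad_erase {n : ℕ} {E : Type*} [DecidableEq E]
    (t : Fin n → Finset E) {C : Finset (Fin n)} {i : Fin n} (hi : i ∈ C) (e : E) :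
    coalitionLoad t C e = coalitionLoad t (C.erase i) e + if e ∈ t i then 1 else 0 := by
  unfold coalitionLoad
  conv_lhs => rw [← Finset.insert_erase hi]
  rw [Finset.filter_insert]
  split_ifs <;> simp

/-- The cost of a coalition member after a deviation is at most her share when the
resources are paid for by the members of the coalition only. -/
theorem agentCostC_combined_le {n : ℕ} {E : Type*} [Fintype E] [DecidableEq E]
    (p : E → ℝ) (hp : ∀ e, 0 ≤ p e) (s t : Fin n → Finset E)
    {C : Finset (Fin n)} {i : Fin n} (hi : i ∈ C) :
    agentCostC p (fun j => if j ∈ C then t j else s j) i ≤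
      ∑ e ∈ t i, p e / (coalitionLoad t C e : ℝ) := by
  unfold agentCostC
  simp only [hi, if_true]
  refine Finset.sum_le_sum fun e he => ?_
  have hpos : 0 < coalitionLoad t C e :=
    Finset.card_pos.2 ⟨i, Finset.mem_filter.2 ⟨hi, he⟩⟩
  exact div_le_div_of_nonneg_left (hp e) (by exact_mod_cast hpos)
    (by exact_mod_cast coalitionLoad_le_resLoad_combined s t C e)

theorem sum_harmonicReal_coalitionLoad_erase {n : ℕ} {E : Type*} [Fintype E] [DecidableEq E]
    (p : E → ℝ) (t : Fin n → Finset E) {C : Finset (Fin n)} {i : Fin n} (hi : i ∈ C) :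
    ∑ e, p e * harmonicReal (coalitionLoad t C e) =
      ∑ e, p e * harmonicReal (coalitionLoad t (C.erase i) e) +
        ∑ e ∈ t i, p e / (coalitionLoad t C e : ℝ) := by
  have hsum : ∑ e ∈ t i, p e / (coalitionLoad t C e : ℝ) =
      ∑ e, if e ∈ t i then p e / (coalitionLoad t C e : ℝ) else 0 := by
    simp
  rw [hsum, ← Finset.sum_add_distrib]
  refine Finset.sum_congr rfl fun e _ => ?_
  rw [coalitionLoad_erase t hi e]
  split_ifs
  · rw [harmonicReal_succ]
    push_cast
    ring
  · simp

/-- If every coalition has a member who does not gain by the joint deviation to `t`, then the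
total cost of any coalition is bounded by its harmonic potential in `t`. -/
theorem sum_agentCostC_le_sum_harmonicReal {n : ℕ} {E : Type*} [Fintype E] [DecidableEq E]
    (p : E → ℝ) (hp : ∀ e, 0 ≤ p e) (s t : Fin n → Finset E)
    (h : ∀ C : Finset (Fin n), C.Nonempty → ∃ i ∈ C,
      agentCostC p s i ≤ agentCostC p (fun j => if j ∈ C then t j else s j) i)
    (C : Finset (Fin n)) :
    ∑ i ∈ C, agentCostC p s i ≤ ∑ e, p e * harmonicReal (coalitionLoad t C e) := by
  induction C using Finset.strongInduction with
  | H C ih =>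
    rcases C.eq_empty_or_nonempty with rfl | hC
    · simp [coalitionLoad, harmonicReal]
    · obtain ⟨i, hi, hle⟩ := h C hC
      rw [← Finset.sum_erase_add _ _ hi, sum_harmonicReal_coalitionLoad_erase p t hi]
      exact add_le_add (ih _ (Finset.erase_ssubset hi))
        (hle.trans (agentCostC_combined_le p hp s t hi))

/-- Let `s` be a strong equilibrium of a capacitated fair cost-sharing congestion game
and let `s*` be a feasible profile such that for every coalition `C` the combined
profile playing `s*` inside `C` and `s` outside `C` is feasible. Then the social cost
of `s` is at most `H_{c_max}` times the social cost of `s*`, where `c_max` is the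
maximal capacity of a resource. -/
theorem SE_cost_le_harmonic_cmax_mul_cost_of_combinable_profile
    {n : ℕ} (hn : 1 ≤ n) {E : Type*} [Fintype E] [DecidableEq E]
    (St : Fin n → Set (Finset E)) (hSt : ∀ i, (St i).Nonempty)
    (p : E → ℝ) (hp : ∀ e, 0 ≤ p e) (c : E → ℕ)
    (s : Fin n → Finset E) (hs : IsStrongEqC St p c s)
    (sstar : Fin n → Finset E) (hstarSt : ∀ i, sstar i ∈ St i)
    (hstar : FeasibleC c sstar)
    (hcomb : ∀ C : Finset (Fin n), FeasibleC c (fun i => if i ∈ C then sstar i else s i)) :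
    socialCostC p s ≤ harmonicReal (Finset.univ.sup c) * socialCostC p sstar := by
  obtain ⟨hsSt, -, hdev⟩ := hs
  have h : ∀ C : Finset (Fin n), C.Nonempty → ∃ i ∈ C,
      agentCostC p s i ≤ agentCostC p (fun j => if j ∈ C then sstar j else s j) i := by
    intro C hC
    by_contra! hlt
    refine hdev ⟨C, _, hC, fun i => ?_, hcomb C, fun i hi => if_neg hi, hlt⟩
    split_ifs
    · exact hstarSt i
    · exact hsSt i
  refine (sum_agentCostC_le_sum_harmonicReal p hp s sstar h Finset.univ).trans ?_
  rw [socialCostC_eq_sum_resources, Finset.mul_sum]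
  refine Finset.sum_le_sum fun e _ => ?_
  change p e * harmonicReal (resLoad sstar e) ≤ _
  rcases Nat.eq_zero_or_pos (resLoad sstar e) with h0 | hpos
  · simp [h0, harmonicReal]
  · rw [mul_div_cancel₀ _ (by exact_mod_cast hpos.ne'), mul_comm]
    exact mul_le_mul_of_nonneg_right
      (harmonicReal_mono ((hstar e).trans (Finset.le_sup (Finset.mem_univ e)))) (hp e)
end

section
/- For every feasible symmetric capacitated cost-sharing game on parallel edges with n agents, every strong equilibrium σ, and every feasible profile τ, the social cost of σ is at most H_n times the social cost of τ, where H_n = 1 + 1/2 + … + 1/n. In particular, the strong price of anarchy of such games is at most H_n. -/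
/-- The load of edge `e` under profile `σ`: the number of agents choosing `e`. -/
def edgeLoad {n : ℕ} {E : Type*} [Fintype E] [DecidableEq E]
    (σ : Fin n → E) (e : E) : ℕ :=
  (Finset.univ.filter fun i => σ i = e).card

/-- A profile is feasible if no edge load exceeds its capacity. -/
def FeasibleP {n : ℕ} {E : Type*} [Fintype E] [DecidableEq E]
    (c : E → ℕ) (σ : Fin n → E) : Prop :=
  ∀ e, edgeLoad σ e ≤ c e

/-- The cost of agent `i`: the cost of her edge divided equally among its users. -/
noncomputable def agentCostP {n : ℕ} {E : Type*} [Fintype E] [DecidableEq E]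
    (p : E → ℝ) (σ : Fin n → E) (i : Fin n) : ℝ :=
  p (σ i) / (edgeLoad σ (σ i) : ℝ)

/-- A feasible profile is a strong equilibrium if no nonempty coalition has a feasible
deviation that strictly decreases the cost of each of its members. -/
def IsStrongEqP {n : ℕ} {E : Type*} [Fintype E] [DecidableEq E]
    (p : E → ℝ) (c : E → ℕ) (σ : Fin n → E) : Prop :=
  FeasibleP c σ ∧
    ¬ ∃ (C : Finset (Fin n)) (σ' : Fin n → E),
        C.Nonempty ∧ FeasibleP c σ' ∧ (∀ i ∉ C, σ' i = σ i) ∧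
        ∀ i ∈ C, agentCostP p σ' i < agentCostP p σ i


/-- The social cost of a profile: the sum of all agents' costs. -/
noncomputable def socialCostP {n : ℕ} {E : Type*} [Fintype E] [DecidableEq E]
    (p : E → ℝ) (σ : Fin n → E) : ℝ :=
  ∑ i, agentCostP p σ i

/-- The agents can be relabelled in `τ` so that no edge is both left and joined
when passing from `σ` to the relabelled profile. -/
theorem exists_perm_left_or_joined {n : ℕ} {E : Type*} [DecidableEq E] (σ τ : Fin n → E) :
    ∃ π : Equiv.Perm (Fin n), ∀ e,
      (∀ i, σ i = e → (τ ∘ π) i = e) ∨ (∀ i, (τ ∘ π) i = e → σ i = e) := by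
  obtain ⟨π, hπ⟩ := Finite.exists_max fun π : Equiv.Perm (Fin n) =>
    (Finset.univ.filter fun i => τ (π i) = σ i).card
  refine ⟨π, fun e => ?_⟩
  by_contra! h
  obtain ⟨⟨i, hi, hi'⟩, j, hj, hj'⟩ := h
  simp only [Function.comp_apply] at hi' hj
  refine (hπ (π * Equiv.swap i j)).not_gt
    (Finset.card_lt_card ?_)
  rw [Finset.ssubset_iff_of_subset]
  · exact ⟨i, Finset.mem_filter.mpr ⟨Finset.mem_univ _, by simp [hi, hj]⟩, by simp [hi, hi']⟩
  · intro k hk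
    simp only [Finset.mem_filter, Finset.mem_univ, true_and] at hk ⊢
    have hki : k ≠ i := by
      rintro rfl
      exact hi' (hk.trans hi)
    have hkj : k ≠ j := by
      rintro rfl
      exact hj' (hk.symm.trans hj)
    simpa [Equiv.swap_apply_of_ne_of_ne hki hkj] using hk

section

variable {n : ℕ} {E : Type*} [Fintype E] [DecidableEq E]

theorem edgeLoad_le_card (σ : Fin n → E) (e : E) : edgeLoad σ e ≤ n := by
  simpa [edgeLoad] using Finset.card_filter_le (Finset.univ : Finset (Fin n)) fun i => σ i = e

theorem edgeLoad_comp_perm (τ : Fin n → E) (π : Equiv.Perm (Fin n)) (e : E) :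
    edgeLoad (τ ∘ π) e = edgeLoad τ e :=
  Finset.card_equiv π fun i => by simp

theorem socialCostP_eq_sum_edges (p : E → ℝ) (τ : Fin n → E) :
    socialCostP p τ = ∑ e, (edgeLoad τ e : ℝ) * (p e / edgeLoad τ e) := by
  unfold socialCostP agentCostP
  rw [← Finset.sum_fiberwise (Finset.univ : Finset (Fin n)) τ]
  refine Finset.sum_congr rfl fun e _ => ?_
  rw [Finset.sum_congr rfl (g := fun _ => p e / (edgeLoad τ e : ℝ))]
  · rw [Finset.sum_const, nsmul_eq_mul]
    rfl
  · intro i hi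
    rw [(Finset.mem_filter.mp hi).2]

theorem feasibleP_piecewise {c : E → ℕ} {σ τ : Fin n → E}
    (hσ : FeasibleP c σ) (hτ : FeasibleP c τ)
    (h : ∀ e, (∀ i, σ i = e → τ i = e) ∨ (∀ i, τ i = e → σ i = e)) (A : Finset (Fin n)) :
    FeasibleP c (A.piecewise τ σ) := by
  intro e
  rcases h e with he | he
  · refine (Finset.card_le_card fun i => ?_).trans (hτ e)
    by_cases hi : i ∈ A <;> simp [hi]
    exact he i
  · refine (Finset.card_le_card fun i => ?_).trans (hσ e)
    by_cases hi : i ∈ A <;> simp [hi]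
    exact he i

/-- If every coalition may feasibly deviate from the strong equilibrium `σ` to `τ`, the cost of a
coalition under `σ` is bounded by the Rosenthal potential of its part of `τ`. -/
theorem IsStrongEqP.sum_agentCostP_le {p : E → ℝ} (hp : ∀ e, 0 ≤ p e) {c : E → ℕ}
    {σ τ : Fin n → E} (hσ : IsStrongEqP p c σ)
    (hfeas : ∀ A : Finset (Fin n), FeasibleP c (A.piecewise τ σ)) (A : Finset (Fin n)) :
    ∑ i ∈ A, agentCostP p σ i ≤
      ∑ e, p e * harmonicReal (A.filter fun i => τ i = e).card := by
  induction A using Finset.strongInduction with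
  | H A ih =>
    rcases A.eq_empty_or_nonempty with rfl | hA
    · simp [harmonicReal]
    obtain ⟨i, hi, hle⟩ : ∃ i ∈ A, agentCostP p σ i ≤ agentCostP p (A.piecewise τ σ) i := by
      by_contra! h
      exact hσ.2 ⟨A, A.piecewise τ σ, hA, hfeas A,
        fun i hi => Finset.piecewise_eq_of_notMem _ _ _ hi, h⟩
    have hcard : ∀ e, (A.filter fun k => τ k = e).card =
        ((A.erase i).filter fun k => τ k = e).card + if τ i = e then 1 else 0 := by
      intro e
      conv_lhs => rw [← Finset.insert_erase hi, Finset.filter_insert]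
      split_ifs
      · exact Finset.card_insert_of_notMem (by simp)
      · rfl
    have hload : (A.filter fun k => τ k = τ i).card ≤ edgeLoad (A.piecewise τ σ) (τ i) := by
      refine Finset.card_le_card fun k hk => ?_
      simp only [Finset.mem_filter] at hk
      simp [hk.1, hk.2]
    have hcost : agentCostP p σ i ≤
        p (τ i) * (1 / (((A.erase i).filter fun k => τ k = τ i).card + 1)) := by
      refine hle.trans ?_
      rw [hcard, if_pos rfl] at hload
      have hload' : ((((A.erase i).filter fun k => τ k = τ i).card : ℝ) + 1) ≤
          edgeLoad (A.piecewise τ σ) (τ i) := by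
        exact_mod_cast hload
      rw [agentCostP, Finset.piecewise_eq_of_mem _ _ _ hi, mul_one_div]
      exact div_le_div_of_nonneg_left (hp _) (by positivity) hload'
    have hpot : ∑ e, p e * harmonicReal (A.filter fun k => τ k = e).card =
        ∑ e, p e * harmonicReal ((A.erase i).filter fun k => τ k = e).card +
          p (τ i) * (1 / (((A.erase i).filter fun k => τ k = τ i).card + 1)) := by
      rw [← Finset.sum_ite_eq (Finset.univ : Finset E) (τ i) (fun e =>
        p e * (1 / ((((A.erase i).filter fun k => τ k = e).card : ℝ) + 1))) |>.trans
          (if_pos (Finset.mem_univ _)), ← Finset.sum_add_distrib]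
      refine Finset.sum_congr rfl fun e _ => ?_
      rw [hcard e]
      split_ifs
      · rw [harmonicReal_succ, mul_add]
      · simp
    rw [hpot, ← Finset.sum_erase_add _ _ hi]
    exact add_le_add (ih _ (Finset.erase_ssubset hi)) hcost

theorem sum_mul_harmonicReal_edgeLoad_le {p : E → ℝ} (hp : ∀ e, 0 ≤ p e) (τ : Fin n → E) :
    ∑ e, p e * harmonicReal (edgeLoad τ e) ≤ harmonicReal n * socialCostP p τ := by
  rw [socialCostP_eq_sum_edges, Finset.mul_sum]
  refine Finset.sum_le_sum fun e _ => ?_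
  rcases Nat.eq_zero_or_pos (edgeLoad τ e) with h | h
  · simp [h, harmonicReal]
  · rw [mul_div_cancel₀ _ (by positivity), mul_comm]
    exact mul_le_mul_of_nonneg_right (harmonicReal_mono (edgeLoad_le_card τ e)) (hp e)

end

/-- In every feasible symmetric capacitated cost-sharing game on parallel edges with
`n` agents, the social cost of any strong equilibrium is at most `H_n` times the social
cost of any feasible profile; in particular the strong price of anarchy is at most `H_n`. -/
theorem parallel_edges_SPoA_le_harmonicReal
    {n : ℕ} (hn : 1 ≤ n) {E : Type*} [Fintype E] [DecidableEq E] [Nonempty E]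
    (p : E → ℝ) (hp : ∀ e, 0 ≤ p e) (c : E → ℕ)
    (σ : Fin n → E) (hσ : IsStrongEqP p c σ)
    (τ : Fin n → E) (hτ : FeasibleP c τ) :
    socialCostP p σ ≤ harmonicReal n * socialCostP p τ := by
  obtain ⟨π, hπ⟩ := exists_perm_left_or_joined σ τ
  have hτπ : FeasibleP c (τ ∘ π) := fun e => (edgeLoad_comp_perm τ π e).trans_le (hτ e)
  calc socialCostP p σ
      ≤ ∑ e, p e * harmonicReal (edgeLoad (τ ∘ π) e) :=
        hσ.sum_agentCostP_le hp (feasibleP_piecewise hσ.1 hτπ hπ) Finset.univ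
    _ = ∑ e, p e * harmonicReal (edgeLoad τ e) := by simp only [edgeLoad_comp_perm]
    _ ≤ harmonicReal n * socialCostP p τ := sum_mul_harmonicReal_edgeLoad_le hp τ
end

section
/- Every feasible single-source capacitated cost-sharing game on a series of k parallel-edge blocks with boundary sinks admits a strong equilibrium. -/
open Finset in
/-- Every finite set in a linear order has an initial segment of each possible size. -/
theorem exists_initial_segment_card {α : Type*} [LinearOrder α] (A : Finset α) (t : ℕ)
    (ht : t ≤ #A) : ∃ B ⊆ A, #B = t ∧ ∀ b ∈ B, ∀ a ∈ A \ B, b < a := by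
  induction t with
  | zero => exact ⟨∅, by simp⟩
  | succ t ih =>
    obtain ⟨B, hBA, hB, hlt⟩ := ih (by omega)
    have hne : (A \ B).Nonempty := by
      rw [← card_pos, card_sdiff_of_subset hBA]
      omega
    have hmem := min'_mem _ hne
    rw [mem_sdiff] at hmem
    refine ⟨insert ((A \ B).min' hne) B, insert_subset hmem.1 hBA, ?_, ?_⟩
    · rw [card_insert_of_notMem hmem.2, hB]
    · intro b hb a ha
      rw [mem_sdiff, mem_insert, not_or] at ha
      have ha' : a ∈ A \ B := mem_sdiff.2 ⟨ha.1, ha.2.2⟩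
      rcases mem_insert.1 hb with rfl | hb
      · exact lt_of_le_of_ne (min'_le _ _ ha') (Ne.symm ha.2.1)
      · exact hlt b hb a ha'

open Finset in
/-- On parallel edges there is a feasible assignment in which no agent can pay less in any feasible
assignment that keeps the choices of all smaller agents. -/
theorem exists_priority_assignment {α F : Type*} [LinearOrder α] [DecidableEq F]
    (q : F → ℝ) (hq : ∀ e, 0 ≤ q e) (d : F → ℕ) (e₀ : F) (S : Finset F) (A : Finset α)
    (hcap : #A ≤ ∑ e ∈ S, d e) :
    ∃ s : α → F, (∀ i ∈ A, s i ∈ S) ∧ (∀ e, #{i ∈ A | s i = e} ≤ d e) ∧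
      ∀ s' : α → F, (∀ i ∈ A, s' i ∈ S) → (∀ e, #{i ∈ A | s' i = e} ≤ d e) →
        ∀ i ∈ A, (∀ i' ∈ A, i' < i → s' i' = s i') →
          q (s i) / (#{a ∈ A | s a = s i} : ℝ) ≤ q (s' i) / (#{a ∈ A | s' a = s' i} : ℝ) := by
  induction S using Finset.strongInduction generalizing A with
  | H S ih =>
  rcases A.eq_empty_or_nonempty with rfl | hA
  · exact ⟨fun _ => e₀, by simp⟩
  have hTne : {e ∈ S | 0 < d e}.Nonempty := by
    have hpos : 0 < ∑ e ∈ S, d e := (card_pos.2 hA).trans_le hcap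
    obtain ⟨e, he, hde⟩ := exists_ne_zero_of_sum_ne_zero hpos.ne'
    exact ⟨e, mem_filter.2 ⟨he, Nat.pos_of_ne_zero hde⟩⟩
  obtain ⟨e, heT, hmin⟩ := exists_min_image _ (fun e => q e / (min (d e) #A : ℕ)) hTne
  obtain ⟨heS, hde⟩ := mem_filter.1 heT
  obtain ⟨B, hBA, hB, hlt⟩ := exists_initial_segment_card A (min (d e) #A) (min_le_right _ _)
  have hfull : ∀ i ∈ A \ B, #B = d e := by
    intro i hi
    have := card_pos.2 ⟨i, hi⟩
    rw [card_sdiff_of_subset hBA] at this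
    omega
  obtain ⟨r, hrS, hrd, hr⟩ := ih (S.erase e) (erase_ssubset heS) (A \ B) (by
    have := add_sum_erase S d heS
    rw [card_sdiff_of_subset hBA]
    omega)
  obtain ⟨s, hsB, hsr⟩ : ∃ s : α → F, (∀ i ∈ B, s i = e) ∧ ∀ i ∈ A \ B, s i = r i :=
    ⟨fun i => if i ∈ B then e else r i, fun i hi => if_pos hi,
      fun i hi => if_neg (mem_sdiff.1 hi).2⟩
  -- Edges other than `e` are used only outside `B` by an assignment sending `B` to `e`.
  have hload : ∀ s : α → F, (∀ i ∈ B, s i = e) → ∀ f ≠ e,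
      ({i ∈ A | s i = f} : Finset α) = {i ∈ A \ B | s i = f} := by
    intro s hs f hf
    ext i
    simp only [mem_filter, mem_sdiff]
    constructor
    · rintro ⟨hi, rfl⟩
      exact ⟨⟨hi, fun h => hf (hs i h)⟩, rfl⟩
    · rintro ⟨⟨hi, -⟩, h⟩
      exact ⟨hi, h⟩
  have hse : ({i ∈ A | s i = e} : Finset α) = B := by
    ext i
    simp only [mem_filter]
    refine ⟨fun ⟨hi, h⟩ => ?_, fun hi => ⟨hBA hi, hsB i hi⟩⟩
    by_contra hiB
    have hi' := mem_sdiff.2 ⟨hi, hiB⟩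
    exact (mem_erase.1 (hrS i hi')).1 ((hsr i hi').symm.trans h)
  have hsf : ∀ f ≠ e, ({i ∈ A | s i = f} : Finset α) = {i ∈ A \ B | r i = f} := by
    intro f hf
    rw [hload s hsB f hf]
    exact filter_congr fun i hi => by rw [hsr i hi]
  refine ⟨s, ?_, ?_, ?_⟩
  · intro i hi
    by_cases hiB : i ∈ B
    · exact (hsB i hiB).symm ▸ heS
    · have hi' := mem_sdiff.2 ⟨hi, hiB⟩
      exact (hsr i hi').symm ▸ mem_of_mem_erase (hrS i hi')
  · intro f
    by_cases hf : f = e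
    · subst hf
      rw [hse, hB]
      exact min_le_left _ _
    · rw [hsf f hf]
      exact hrd f
  · intro s' hs'S hs'd i hi hagree
    by_cases hiB : i ∈ B
    · have hsi : s i = e := hsB i hiB
      rw [hsi, hse, hB]
      have hpos : 0 < #{a ∈ A | s' a = s' i} := card_pos.2 ⟨i, mem_filter.2 ⟨hi, rfl⟩⟩
      have hle := hs'd (s' i)
      refine (hmin (s' i) (mem_filter.2 ⟨hs'S i hi, hpos.trans_le hle⟩)).trans ?_
      have hle' : #{a ∈ A | s' a = s' i} ≤ min (d (s' i)) #A := le_min hle (card_filter_le _ _)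
      exact div_le_div_of_nonneg_left (hq _) (by exact_mod_cast hpos) (by exact_mod_cast hle')
    · have hi' := mem_sdiff.2 ⟨hi, hiB⟩
      have hs'B : ∀ b ∈ B, s' b = e := fun b hb =>
        (hagree b (hBA hb) (hlt b hb i hi')).trans (hsB b hb)
      have hs'e : ∀ a ∈ A \ B, s' a ≠ e := by
        intro a ha hae
        rw [mem_sdiff] at ha
        have hsub : insert a B ⊆ {i ∈ A | s' i = e} := by
          intro b hb
          rcases mem_insert.1 hb with rfl | hb
          · exact mem_filter.2 ⟨ha.1, hae⟩
          · exact mem_filter.2 ⟨hBA hb, hs'B b hb⟩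
        have := (card_le_card hsub).trans (hs'd e)
        rw [card_insert_of_notMem ha.2, hfull i hi'] at this
        omega
      have hsi : s i = r i := hsr i hi'
      rw [hsi, hsf _ (mem_erase.1 (hrS i hi')).1, hload s' hs'B _ (hs'e i hi')]
      refine hr s' (fun a ha => mem_erase.2 ⟨hs'e a ha, hs'S a (mem_sdiff.1 ha).1⟩) ?_ i hi' ?_
      · exact fun f => (card_le_card (filter_subset_filter _ sdiff_subset)).trans (hs'd f)
      · exact fun a ha hai => (hagree a (mem_sdiff.1 ha).1 hai).trans (hsr a ha)


/-- The load of edge `e` of block `j`: the number of agents whose path reaches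
block `j` (i.e. `j < m i`, with blocks indexed from `0`) and who chose `e` there. -/
def ssLoad {n k : ℕ} {E : Fin k → Type*} [∀ j, Fintype (E j)] [∀ j, DecidableEq (E j)]
    (m : Fin n → ℕ) (σ : Fin n → ∀ j, E j) (j : Fin k) (e : E j) : ℕ :=
  (Finset.univ.filter fun i => (j : ℕ) < m i ∧ σ i j = e).card

/-- A profile is feasible if no edge load exceeds its capacity. -/
def FeasibleS {n k : ℕ} {E : Fin k → Type*} [∀ j, Fintype (E j)] [∀ j, DecidableEq (E j)]
    (m : Fin n → ℕ) (c : ∀ j, E j → ℕ) (σ : Fin n → ∀ j, E j) : Prop :=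
  ∀ j e, ssLoad m σ j e ≤ c j e

/-- The cost of agent `i`: over the blocks her path traverses, the cost of her chosen
edge divided equally among its users. -/
noncomputable def agentCostS {n k : ℕ} {E : Fin k → Type*}
    [∀ j, Fintype (E j)] [∀ j, DecidableEq (E j)]
    (m : Fin n → ℕ) (p : ∀ j, E j → ℝ) (σ : Fin n → ∀ j, E j) (i : Fin n) : ℝ :=
  ∑ j : Fin k, if (j : ℕ) < m i then p j (σ i j) / (ssLoad m σ j (σ i j) : ℝ) else 0

/-- The social cost of a profile: the sum of all agents' costs. -/
noncomputable def socialCostS {n k : ℕ} {E : Fin k → Type*}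
    [∀ j, Fintype (E j)] [∀ j, DecidableEq (E j)]
    (m : Fin n → ℕ) (p : ∀ j, E j → ℝ) (σ : Fin n → ∀ j, E j) : ℝ :=
  ∑ i, agentCostS m p σ i

/-- A feasible profile is a strong equilibrium if no nonempty coalition has a feasible
deviation, agreeing with the original profile outside the coalition (on all blocks its
members actually traverse), that strictly decreases the cost of each of its members. -/
def IsStrongEqS {n k : ℕ} {E : Fin k → Type*} [∀ j, Fintype (E j)] [∀ j, DecidableEq (E j)]
    (m : Fin n → ℕ) (p : ∀ j, E j → ℝ) (c : ∀ j, E j → ℕ) (σ : Fin n → ∀ j, E j) : Prop :=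
  FeasibleS m c σ ∧
    ¬ ∃ (C : Finset (Fin n)) (σ' : Fin n → ∀ j, E j),
        C.Nonempty ∧ FeasibleS m c σ' ∧
        (∀ i ∉ C, ∀ j : Fin k, (j : ℕ) < m i → σ' i j = σ i j) ∧
        ∀ i ∈ C, agentCostS m p σ' i < agentCostS m p σ i

/-- Every feasible single-source capacitated cost-sharing game on a series of `k`
parallel-edge blocks with boundary sinks admits a strong equilibrium. -/
theorem single_source_blocks_admits_strong_equilibrium
    {n k : ℕ} (hn : 1 ≤ n) (hk : 1 ≤ k)
    {E : Fin k → Type*} [∀ j, Fintype (E j)] [∀ j, DecidableEq (E j)] [∀ j, Nonempty (E j)]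
    (p : ∀ j, E j → ℝ) (hp : ∀ j e, 0 ≤ p j e) (c : ∀ j, E j → ℕ)
    (m : Fin n → ℕ) (hm : ∀ i, 1 ≤ m i ∧ m i ≤ k)
    (hfeas : ∃ σ : Fin n → ∀ j, E j, FeasibleS m c σ) :
    ∃ σ : Fin n → ∀ j, E j, IsStrongEqS m p c σ := by
  classical
  obtain ⟨τ, hτ⟩ := hfeas
  have hload (σ : Fin n → ∀ j, E j) (j : Fin k) (e : E j) : ssLoad m σ j e =
      (({i | (j : ℕ) < m i} : Finset (Fin n)).filter fun i => σ i j = e).card := by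
    rw [Finset.filter_filter]
    rfl
  have hblock := fun j : Fin k => exists_priority_assignment (p j) (hp j) (c j)
    (Classical.arbitrary _) Finset.univ ({i | (j : ℕ) < m i} : Finset (Fin n)) (by
      rw [Finset.card_eq_sum_card_fiberwise (f := fun i => τ i j) (t := Finset.univ) (by simp)]
      exact Finset.sum_le_sum fun e _ => (hload τ j e).symm.trans_le (hτ j e))
  choose s _ hsc hs using hblock
  refine ⟨fun i j => s j i, fun j e => (hload _ j e).trans_le (hsc j e), ?_⟩
  rintro ⟨C, σ', hC, hσ', hagree, hlt⟩
  refine (hlt _ (C.min'_mem hC)).not_ge (Finset.sum_le_sum fun j _ => ?_)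
  split_ifs with hj
  · rw [hload, hload]
    refine hs j (fun i => σ' i j) (by simp) (fun e => (hload σ' j e).symm.trans_le (hσ' j e)) _
      (by simpa using hj) fun i hi hlt' => ?_
    exact hagree i (fun hiC => (C.min'_le i hiC).not_gt hlt') j (by simpa using hi)
  · exact le_rfl
end
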